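/- Fix x₀ ∈ X and an integer K ≥ 2. For each index sequence j = (j₂,…,j_K) ∈ {1,…,n}^{K−1}, define iterates as follows: ȳ₀ = y₀ = Ax₀; x₁ = the minimizer over X of a₁·⟨Aᵀy₀ − 𝟙, x⟩ + (1/2)‖x − x₀‖_Λ²; for k ≥ 2, x_k = the minimizer over X of φ_k(x) = a₁·⟨Aᵀȳ₀ − 𝟙, x⟩ + Σ_{i=2}^k n·a_i·(Aᵀȳ_{i−1} − 𝟙)_{j_i}·x_{j_i} + (1/2)‖x − x₀‖_Λ²; x̃₁ = x₁ and, for k ≥ 2, x̃_k = (1/A_k)·(A_{k−1}·x̃_{k−1} + a_k·(n·x_k − (n−1)·x_{k−1})); y_k = A·x̃_k for k ≥ 1; and ȳ_k = y_k + (a_k/a_{k+1})·(y_k − y_{k−1}) for k ≥ 1. Then the uniform average over all n^{K−1} index sequences j satisfies: (1/n^{K−1})·Σ_j (f(x̃_K) − f(x⋆)) ≤ ‖x₀ − x⋆‖_Λ²/(2·A_K), and moreover (1/n^{K−1})·Σ_j ⟨∇f(x̃_K), x̃_K − x⋆⟩ ≤ ‖x₀ − x⋆‖_Λ²/A_K.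 -/

import Mathlib

open Finset

namespace SINNLS

/-- positivity and growth facts for the step sizes -/
theorem seq_facts {n : ℕ} (hn : 4 ≤ n) (a Aseq : ℕ → ℝ)
    (ha1 : a 1 = 1 / (Real.sqrt 2 * (n : ℝ) ^ ((3:ℝ)/2)))
    (ha2 : a 2 = a 1 / ((n : ℝ) - 1))
    (hA0 : Aseq 0 = 0)
    (hArec : ∀ k, Aseq (k+1) = Aseq k + a (k+1))
    (harec : ∀ k, 1 ≤ k →
      a (k+2) = min ((n : ℝ) * a (k+1) / ((n : ℝ) - 1)) (Real.sqrt (Aseq (k+1)) / (2 * n))) :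
    (∀ k, 1 ≤ k → 0 < a k ∧ 0 < Aseq k) ∧
    (∀ k, 1 ≤ k → 4 * (n : ℝ)^2 * a (k+1)^2 ≤ Aseq k) ∧
    (∀ k, 1 ≤ k → ((n : ℝ) - 1) * a (k+1) ≤ n * a k) ∧
    (n : ℝ)^3 * a 1 ^2 = 1/2 := by
  have hn' : (4 : ℝ) ≤ n := by exact_mod_cast hn
  have hn0 : (0 : ℝ) < n := by linarith
  have hn1 : (0 : ℝ) < (n : ℝ) - 1 := by linarith
  have hp : (0 : ℝ) < (n : ℝ) ^ ((3:ℝ)/2) := Real.rpow_pos_of_pos hn0 _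
  have hp2 : ((n : ℝ) ^ ((3:ℝ)/2))^2 = (n : ℝ)^3 := by
    rw [← Real.rpow_natCast, ← Real.rpow_mul hn0.le, ← Real.rpow_natCast]
    norm_num
  have ha1pos : 0 < a 1 := by rw [ha1]; positivity
  have hsq : (n : ℝ)^3 * a 1 ^2 = 1/2 := by
    rw [ha1, div_pow, mul_pow, hp2, Real.sq_sqrt (by norm_num)]
    field_simp
  have hA1 : Aseq 1 = a 1 := by have := hArec 0; simpa [hA0] using this
  have ha2pos : 0 < a 2 := by rw [ha2]; positivity
  have hpos : ∀ k, 1 ≤ k → 0 < a k ∧ 0 < Aseq k ∧ 0 < a (k+1) := by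
    intro k hk
    induction k, hk using Nat.le_induction with
    | base => exact ⟨ha1pos, hA1 ▸ ha1pos, ha2pos⟩
    | succ k hk ih =>
      obtain ⟨h1, h2, h3⟩ := ih
      have h4 : 0 < Aseq (k+1) := by rw [hArec]; linarith
      refine ⟨h3, h4, ?_⟩
      rw [show k + 1 + 1 = k + 2 from rfl, harec k hk]
      apply lt_min
      · positivity
      · have := Real.sqrt_pos.2 h4
        positivity
  refine ⟨fun k hk => ⟨(hpos k hk).1, (hpos k hk).2.1⟩, ?_, ?_, hsq⟩
  · intro k hk
    rcases Nat.lt_or_ge 1 k with h | h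
    · obtain ⟨l, rfl⟩ : ∃ l, k = l + 1 := ⟨k - 1, by omega⟩
      have h1 := (hpos (l+1) hk)
      have h2 : a (l+2) ≤ Real.sqrt (Aseq (l+1)) / (2 * n) := by
        rw [harec l (by omega)]; exact min_le_right _ _
      have h3 : 2 * n * a (l+2) ≤ Real.sqrt (Aseq (l+1)) := by
        rw [le_div_iff₀ (by positivity)] at h2; linarith
      have h4 : (2 * n * a (l+2))^2 ≤ Real.sqrt (Aseq (l+1))^2 := by
        have : 0 < a (l+2) := h1.2.2
        gcongr
      rw [Real.sq_sqrt h1.2.1.le] at h4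
      calc _ = (2 * n * a (l+2))^2 := by ring_nf
        _ ≤ _ := h4
    · obtain rfl : k = 1 := by omega
      rw [hA1, show 1 + 1 = 2 from rfl, ha2, div_pow, mul_div_assoc', div_le_iff₀ (by positivity)]
      -- 4 n² a1² ≤ a1 (n-1)²
      have h5 : 64 * a 1 ^ 2 ≤ 1 / 2 := by
        rw [← hsq]
        have : (4:ℝ)^3 ≤ (n:ℝ)^3 := by gcongr
        nlinarith [sq_nonneg (a 1)]
      have h6 : a 1 ≤ 9 / 64 := by nlinarith
      have h7 : 9 / 16 * (n:ℝ)^2 ≤ ((n:ℝ) - 1)^2 := by nlinarith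
      have h8 : 4 * (n:ℝ)^2 * a 1 ≤ ((n:ℝ) - 1)^2 := by nlinarith [sq_nonneg (n:ℝ)]
      nlinarith
  · intro k hk
    rcases Nat.lt_or_ge 1 k with h | h
    · obtain ⟨l, rfl⟩ : ∃ l, k = l + 1 := ⟨k - 1, by omega⟩
      have h2 : a (l+2) ≤ (n : ℝ) * a (l+1) / ((n : ℝ) - 1) := by
        rw [harec l (by omega)]; exact min_le_left _ _
      rw [le_div_iff₀ hn1] at h2
      rw [show l + 1 + 1 = l + 2 from rfl]; linarith
    · obtain rfl : k = 1 := by omega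
      rw [show 1 + 1 = 2 from rfl, ha2, mul_div_cancel₀ _ hn1.ne']
      nlinarith

/-- averaging over one coordinate of the index sequence -/
theorem avg_coord {N n : ℕ} (p : Fin N) (F : (Fin N → Fin n) → Fin n → ℝ)
    (hF : ∀ js c d, F (Function.update js p d) c = F js c) :
    (n : ℝ) * ∑ js, F js (js p) = ∑ js, ∑ c, F js c := by
  have h1 : ∑ js, ∑ c, F js c = ∑ q : (Fin N → Fin n) × Fin n, F q.1 q.2 := by
    rw [Fintype.sum_prod_type]
  let σ : (Fin N → Fin n) × Fin n → (Fin N → Fin n) × Fin n :=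
    fun q => (Function.update q.1 p q.2, q.1 p)
  have hσ : Function.Involutive σ := by
    rintro ⟨js, c⟩
    simp [σ]
  have h2 : ∑ q : (Fin N → Fin n) × Fin n, F q.1 q.2
      = ∑ q : (Fin N → Fin n) × Fin n, F (σ q).1 (σ q).2 :=
    (Equiv.sum_comp hσ.toPerm (fun q : (Fin N → Fin n) × Fin n => F q.1 q.2)).symm
  rw [h1, h2, Fintype.sum_prod_type]
  simp only [σ, hF]
  simp [Finset.mul_sum]

theorem grad_sum {m n : ℕ} (A : Matrix (Fin m) (Fin n) ℝ) (v : Fin m → ℝ) (z : Fin n → ℝ) :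
    ∑ j, ((∑ i, A i j * v i) - 1) * z j = ∑ i, v i * A.mulVec z i - ∑ j, z j := by
  simp only [sub_mul, one_mul, Finset.sum_sub_distrib, Matrix.mulVec, dotProduct]
  congr 1
  simp only [Finset.sum_mul, Finset.mul_sum]
  rw [Finset.sum_comm]
  refine Finset.sum_congr rfl fun i _ => Finset.sum_congr rfl fun j _ => by ring

theorem mulVec_sq_le {m n : ℕ} (A : Matrix (Fin m) (Fin n) ℝ) (z : Fin n → ℝ) :
    ∑ i, (A.mulVec z i)^2 ≤ n * ∑ j, (∑ i, (A i j)^2) * (z j)^2 := by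
  have h : ∀ i, (A.mulVec z i)^2 ≤ n * ∑ j, (A i j * z j)^2 := by
    intro i
    have := sq_sum_le_card_mul_sum_sq (s := (Finset.univ : Finset (Fin n)))
      (f := fun j => A i j * z j)
    simpa [Matrix.mulVec, dotProduct] using this
  calc _ ≤ ∑ i, (n : ℝ) * ∑ j, (A i j * z j)^2 := Finset.sum_le_sum fun i _ => h i
    _ = _ := by
      rw [← Finset.mul_sum, Finset.sum_comm]
      simp only [mul_pow, Finset.sum_mul]

theorem mulVec_sq_single {m n : ℕ} (A : Matrix (Fin m) (Fin n) ℝ) (z : Fin n → ℝ) (p : Fin n)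
    (hz : ∀ j, j ≠ p → z j = 0) :
    ∑ i, (A.mulVec z i)^2 = ∑ j, (∑ i, (A i j)^2) * (z j)^2 := by
  have h1 : ∀ i, A.mulVec z i = A i p * z p := by
    intro i
    simp only [Matrix.mulVec, dotProduct]
    exact Finset.sum_eq_single p (fun j _ hj => by rw [hz j hj, mul_zero]) (by simp)
  rw [Finset.sum_eq_single p (fun j _ hj => by rw [hz j hj]; simp) (by simp)]
  simp only [h1, mul_pow, Finset.sum_mul]

/-- a quadratic which is nonnegative on (0,1] has nonnegative slope -/
theorem slope_nonneg (L N : ℝ) (h : ∀ t : ℝ, 0 < t → t ≤ 1 → 0 ≤ t * L + t^2 * N) : 0 ≤ L := by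
  by_contra hL
  push Not at hL
  have hN : 0 < N := by have := h 1 one_pos le_rfl; nlinarith
  have ht : 0 < min 1 (-L / (2 * N)) := lt_min one_pos (div_pos (by linarith) (by linarith))
  have h1 := h _ ht (min_le_left _ _)
  have h2 : min 1 (-L / (2 * N)) ≤ -L / (2*N) := min_le_right _ _
  rw [le_div_iff₀ (by linarith)] at h2
  nlinarith

theorem quad_expand {n : ℕ} (lam c x0 x z : Fin n → ℝ) :
    (∑ j, c j * z j + (1/2) * ∑ j, lam j * (z j - x0 j)^2) =
    (∑ j, c j * x j + (1/2) * ∑ j, lam j * (x j - x0 j)^2)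
    + ∑ j, (c j + lam j * (x j - x0 j)) * (z j - x j)
    + (1/2) * ∑ j, lam j * (z j - x j)^2 := by
  simp only [Finset.mul_sum, ← Finset.sum_add_distrib]
  refine Finset.sum_congr rfl fun j _ => by ring

/-- coordinatewise first order condition -/
theorem first_order {n : ℕ} (lam c x0 x u : Fin n → ℝ)
    (hx : ∀ j, 0 ≤ x j ∧ x j ≤ u j)
    (hmin : ∀ z : Fin n → ℝ, (∀ j, 0 ≤ z j ∧ z j ≤ u j) →
      (∑ j, c j * x j + (1/2) * ∑ j, lam j * (x j - x0 j)^2) ≤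
      (∑ j, c j * z j + (1/2) * ∑ j, lam j * (z j - x0 j)^2))
    (j : Fin n) (t : ℝ) (ht0 : 0 ≤ t) (ht1 : t ≤ u j) :
    0 ≤ (c j + lam j * (x j - x0 j)) * (t - x j) := by
  apply slope_nonneg _ ((1/2) * lam j * (t - x j)^2)
  intro s hs0 hs1
  have h := hmin (Function.update x j (x j + s * (t - x j))) (by
    intro i
    rcases eq_or_ne i j with rfl | hij
    · simp only [Function.update_self]
      have := hx i
      constructor <;> nlinarith
    · simpa [Function.update_of_ne hij] using hx i)
  rw [quad_expand lam c x0 x (Function.update x j (x j + s * (t - x j)))] at h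
  rw [Finset.sum_eq_single j (f := fun j' => (c j' + lam j' * (x j' - x0 j')) * (_ - x j'))
      (fun i _ hij => by rw [Function.update_of_ne hij]; ring) (by simp),
    Finset.sum_eq_single j (f := fun j' => lam j' * (_ - x j')^2)
      (fun i _ hij => by rw [Function.update_of_ne hij]; ring) (by simp)] at h
  simp only [Function.update_self] at h
  nlinarith

theorem coord_unique (l c x x' x0 : ℝ) (hl : 0 < l)
    (h1 : 0 ≤ (c + l * (x - x0)) * (x' - x)) (h2 : 0 ≤ (c + l * (x' - x0)) * (x - x')) :
    x = x' := by
  have : l * (x - x')^2 ≤ 0 := by nlinarith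
  have h3 : (x - x')^2 ≤ 0 := by
    by_contra h; push Not at h; nlinarith [mul_pos hl h]
  have : x - x' = 0 := by nlinarith [sq_nonneg (x-x')]
  linarith

/-- the scalar one-step inequality -/
theorem scalar_step (n a a' B y y' s u u' d' yb : ℝ) (hn : 1 ≤ n) (ha : 0 < a) (ha' : 0 < a')
    (hB : 4 * n^2 * a^2 ≤ B)
    (hyb : a * yb = a * y' + a' * d')
    (hy : (B + a) * y = B * y' + a * (n * u - (n-1) * u')) :
    (1/2) * (B + a) * (y^2 - s^2) - (1/2) * B * (y'^2 - s^2) - a * (y - y') * (u - s)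
      + a' * d' * (u' - s) + n^2 * a^2 * (y - y')^2 - n^2 * a'^2 * d'^2
    ≤ (1/2) * (u - u')^2 + a * yb * (n * u - (n-1) * u' - s) := by
  rw [hyb]
  have hu : a * (n * u - (n-1) * u') = (B + a) * y - B * y' := by linarith
  have e : (a * y' + a' * d') * (n * u - (n-1) * u' - s) =
      a * y * (n * u - (n-1) * u' - s)
       - (a * (y - y') - a' * d') * (n * u - (n-1) * u' - s) := by ring
  have e2 : a * y * (n * u - (n-1) * u' - s) = y * ((B + a) * y - B * y') - a * y * s := by
    rw [← hu]; ring
  have k1 : (n-1) * a * (y - y') * (u - u') ≤ n^2 * a^2 * (y-y')^2 + (1/4) * (u-u')^2 := by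
    have : (n-1)^2 * (a^2 * (y-y')^2) ≤ n^2 * (a^2 * (y-y')^2) := by
      apply mul_le_mul_of_nonneg_right _ (by positivity)
      nlinarith
    nlinarith [sq_nonneg ((n-1) * a * (y-y') - (1/2) * (u-u'))]
  have k2 : -(n * a' * d' * (u - u')) ≤ n^2 * a'^2 * d'^2 + (1/4) * (u-u')^2 := by
    nlinarith [sq_nonneg (n * a' * d' + (1/2) * (u-u'))]
  have k3 : 4 * n^2 * a^2 * (y-y')^2 ≤ B * (y-y')^2 :=
    mul_le_mul_of_nonneg_right hB (sq_nonneg _)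
  have k4 : 0 ≤ a * (y - s)^2 := by positivity
  rw [e, e2]
  nlinarith

end SINNLS

namespace SINNLS

/-- linear coefficients of the dual estimate function -/
noncomputable def coef {n : ℕ} (a : ℕ → ℝ) (g : ℕ → Fin n → ℝ) (J : ℕ → Fin n) (k : ℕ)
    (j : Fin n) : ℝ :=
  a 1 * g 1 j + ∑ i ∈ Finset.Icc 2 k, if J i = j then (n : ℝ) * a i * g i (J i) else 0

/-- the dual estimate function -/
noncomputable def est {n : ℕ} (a : ℕ → ℝ) (g : ℕ → Fin n → ℝ) (J : ℕ → Fin n)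
    (lam x0 : Fin n → ℝ) (k : ℕ) (z : Fin n → ℝ) : ℝ :=
  a 1 * (∑ j, g 1 j * z j)
  + (∑ i ∈ Finset.Icc 2 k, (n : ℝ) * a i * (g i (J i) * z (J i)))
  + (1/2) * ∑ j, lam j * (z j - x0 j)^2

theorem est_eq {n : ℕ} (a : ℕ → ℝ) (g : ℕ → Fin n → ℝ) (J : ℕ → Fin n)
    (lam x0 : Fin n → ℝ) (k : ℕ) (z : Fin n → ℝ) :
    est a g J lam x0 k z
      = ∑ j, coef a g J k j * z j + (1/2) * ∑ j, lam j * (z j - x0 j)^2 := by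
  unfold est coef
  congr 1
  simp only [add_mul, Finset.sum_add_distrib, Finset.sum_mul]
  congr 1
  · rw [Finset.mul_sum]
    exact Finset.sum_congr rfl fun j _ => by ring
  · rw [Finset.sum_comm]
    refine Finset.sum_congr rfl fun i _ => ?_
    simp only [ite_mul, zero_mul, Finset.sum_ite_eq, Finset.mem_univ, if_true]
    ring

/-- coordinatewise optimality -/
theorem est_first_order {n : ℕ} (a : ℕ → ℝ) (g : ℕ → Fin n → ℝ) (J : ℕ → Fin n)
    (lam x0 u x : Fin n → ℝ) (k : ℕ)
    (hx : ∀ j, 0 ≤ x j ∧ x j ≤ u j)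
    (hmin : ∀ z : Fin n → ℝ, (∀ j, 0 ≤ z j ∧ z j ≤ u j) →
      est a g J lam x0 k x ≤ est a g J lam x0 k z)
    (j : Fin n) (t : ℝ) (ht : 0 ≤ t ∧ t ≤ u j) :
    0 ≤ (coef a g J k j + lam j * (x j - x0 j)) * (t - x j) := by
  apply first_order lam (coef a g J k) x0 x u hx _ j t ht.1 ht.2
  intro z hz
  have := hmin z hz
  rwa [est_eq, est_eq] at this

theorem est_strong {n : ℕ} (a : ℕ → ℝ) (g : ℕ → Fin n → ℝ) (J : ℕ → Fin n)
    (lam x0 u x : Fin n → ℝ) (k : ℕ)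
    (hx : ∀ j, 0 ≤ x j ∧ x j ≤ u j)
    (hmin : ∀ z : Fin n → ℝ, (∀ j, 0 ≤ z j ∧ z j ≤ u j) →
      est a g J lam x0 k x ≤ est a g J lam x0 k z)
    (z : Fin n → ℝ) (hz : ∀ j, 0 ≤ z j ∧ z j ≤ u j) :
    est a g J lam x0 k x + (1/2) * ∑ j, lam j * (z j - x j)^2 ≤ est a g J lam x0 k z := by
  rw [est_eq, est_eq, quad_expand lam (coef a g J k) x0 x z]
  have := Finset.sum_nonneg (s := Finset.univ) fun j _ =>
    est_first_order a g J lam x0 u x k hx hmin j (z j) (hz j)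
  linarith

theorem coef_succ_ne {n : ℕ} (a : ℕ → ℝ) (g : ℕ → Fin n → ℝ) (J : ℕ → Fin n) (k : ℕ)
    (hk : 1 ≤ k) (j : Fin n) (hj : j ≠ J (k+1)) : coef a g J (k+1) j = coef a g J k j := by
  unfold coef
  rw [Finset.sum_Icc_succ_top (by omega), if_neg (Ne.symm hj), add_zero]

/-- the telescoped lower bound on the estimate sequence -/
theorem potential {n : ℕ} (a : ℕ → ℝ) (g : ℕ → Fin n → ℝ) (J : ℕ → Fin n)
    (lam x0 u xs : Fin n → ℝ) (x : ℕ → Fin n → ℝ) (K : ℕ) (hK : 1 ≤ K)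
    (hx : ∀ k, 1 ≤ k → k ≤ K → ∀ j, 0 ≤ x k j ∧ x k j ≤ u j)
    (hmin : ∀ k, 1 ≤ k → k ≤ K → ∀ z : Fin n → ℝ, (∀ j, 0 ≤ z j ∧ z j ≤ u j) →
      est a g J lam x0 k (x k) ≤ est a g J lam x0 k z)
    (hxs : ∀ j, 0 ≤ xs j ∧ xs j ≤ u j) :
    (1/2) * ∑ j, lam j * (xs j - x K j)^2
    + (a 1 * ∑ j, g 1 j * (x 1 j - xs j) + (1/2) * ∑ j, lam j * (x 1 j - x0 j)^2)
    + ∑ i ∈ Finset.Icc 2 K, ((1/2) * ∑ j, lam j * (x i j - x (i-1) j)^2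
        + (n : ℝ) * a i * (g i (J i) * (x i (J i) - xs (J i))))
    ≤ (1/2) * ∑ j, lam j * (xs j - x0 j)^2 := by
  have key : ∀ k, 1 ≤ k → k ≤ K →
      a 1 * ∑ j, g 1 j * x 1 j + (1/2) * ∑ j, lam j * (x 1 j - x0 j)^2
      + ∑ i ∈ Finset.Icc 2 k, ((1/2) * ∑ j, lam j * (x i j - x (i-1) j)^2
        + (n : ℝ) * a i * (g i (J i) * x i (J i))) ≤ est a g J lam x0 k (x k) := by
    intro k hk
    induction k, hk using Nat.le_induction with
    | base => intro _; simp [est]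
    | succ k hk ih =>
      intro hkK
      have ih := ih (by omega)
      have h := est_strong a g J lam x0 u (x k) k (hx k hk (by omega)) (hmin k hk (by omega))
        (x (k+1)) (hx (k+1) (by omega) hkK)
      have h2 : est a g J lam x0 (k+1) (x (k+1)) = est a g J lam x0 k (x (k+1))
          + (n : ℝ) * a (k+1) * (g (k+1) (J (k+1)) * x (k+1) (J (k+1))) := by
        unfold est
        rw [Finset.sum_Icc_succ_top (by omega)]; ring
      rw [Finset.sum_Icc_succ_top (by omega), h2]
      simp only [Nat.add_sub_cancel]
      linarith
  have h1 := key K hK le_rfl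
  have h2 := est_strong a g J lam x0 u (x K) K (hx K hK le_rfl) (hmin K hK le_rfl) xs hxs
  unfold est at h1 h2
  have e1 : ∑ j, g 1 j * (x 1 j - xs j) = ∑ j, g 1 j * x 1 j - ∑ j, g 1 j * xs j := by
    rw [← Finset.sum_sub_distrib]; exact Finset.sum_congr rfl fun j _ => by ring
  have e2 : ∑ i ∈ Finset.Icc 2 K, ((1/2) * ∑ j, lam j * (x i j - x (i-1) j)^2
        + (n : ℝ) * a i * (g i (J i) * (x i (J i) - xs (J i))))
      = ∑ i ∈ Finset.Icc 2 K, ((1/2) * ∑ j, lam j * (x i j - x (i-1) j)^2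
        + (n : ℝ) * a i * (g i (J i) * x i (J i)))
        - ∑ i ∈ Finset.Icc 2 K, (n : ℝ) * a i * (g i (J i) * xs (J i)) := by
    rw [← Finset.sum_sub_distrib]; exact Finset.sum_congr rfl fun j _ => by ring
  rw [e1, e2]
  linarith

/-- the deterministic descent inequality -/
theorem descent {m n : ℕ} (hn : 1 ≤ n) (A : Matrix (Fin m) (Fin n) ℝ) (a Aseq : ℕ → ℝ)
    (hpos : ∀ k, 1 ≤ k → 0 < a k ∧ 0 < Aseq k)
    (hgrow : ∀ k, 1 ≤ k → 4 * (n : ℝ)^2 * a (k+1)^2 ≤ Aseq k)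
    (hfirst : (n : ℝ)^3 * a 1 ^2 = 1/2)
    (hA0 : Aseq 0 = 0)
    (hArec : ∀ k, Aseq (k+1) = Aseq k + a (k+1))
    (K : ℕ) (x0 xs : Fin n → ℝ) (J : ℕ → Fin n)
    (x xt : ℕ → Fin n → ℝ) (y yb : ℕ → Fin m → ℝ)
    (hy0 : y 0 = A.mulVec x0) (hyb0 : yb 0 = A.mulVec x0)
    (hxt1 : xt 1 = x 1)
    (hxt : ∀ k, 1 ≤ k → k + 1 ≤ K → ∀ j, Aseq (k+1) * xt (k+1) j =
      Aseq k * xt k j + a (k+1) * ((n : ℝ) * x (k+1) j - ((n : ℝ) - 1) * x k j))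
    (hy : ∀ k, 1 ≤ k → k ≤ K → y k = A.mulVec (xt k))
    (hyb : ∀ k, 1 ≤ k → k + 1 ≤ K →
      yb k = y k + (a k / a (k+1)) • (y k - y (k-1)))
    (hsingle : ∀ k, 1 ≤ k → k + 1 ≤ K → ∀ j, j ≠ J (k+1) → x (k+1) j = x k j)
    (k : ℕ) (hk : 1 ≤ k) (hkK : k ≤ K) :
    Aseq k * (((1/2) * ∑ i, (y k i)^2 - ∑ j, xt k j)
        - ((1/2) * ∑ i, (A.mulVec xs i)^2 - ∑ j, xs j))
      - a k * ∑ i, (y k i - y (k-1) i) * (A.mulVec (x k) i - A.mulVec xs i)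
      + (n : ℝ)^2 * a k^2 * ∑ i, (y k i - y (k-1) i)^2
    ≤ (a 1 * ∑ j, ((∑ i, A i j * yb 0 i) - 1) * (x 1 j - xs j)
        + (1/2) * ∑ j, (∑ i, (A i j)^2) * (x 1 j - x0 j)^2)
      + ∑ i ∈ Finset.Icc 2 k, ((1/2) * ∑ j, (∑ i, (A i j)^2) * (x i j - x (i-1) j)^2
        + a i * ∑ j, ((∑ i', A i' j * yb (i-1) i') - 1)
            * (((n : ℝ) * x i j - ((n : ℝ) - 1) * x (i-1) j) - xs j)) := by
  have hn' : (1 : ℝ) ≤ n := by exact_mod_cast hn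
  induction k, hk using Nat.le_induction with
  | base =>
    have hA1 : Aseq 1 = a 1 := by have := hArec 0; simpa [hA0] using this
    have ha := (hpos 1 le_rfl).1
    have hG := grad_sum A (yb 0) (fun j => x 1 j - xs j)
    have hC := mulVec_sq_le A (fun j => x 1 j - x0 j)
    have hs1 : A.mulVec (fun j => x 1 j - xs j) = A.mulVec (x 1) - A.mulVec xs :=
      Matrix.mulVec_sub A (x 1) xs
    have hs2 : A.mulVec (fun j => x 1 j - x0 j) = A.mulVec (x 1) - A.mulVec x0 :=
      Matrix.mulVec_sub A (x 1) x0
    rw [hG, hs1, hyb0]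
    rw [hs2] at hC
    simp only [Nat.sub_self, hA1]
    rw [hy 1 le_rfl hkK, hy0, hxt1]
    simp only [Pi.sub_apply] at hC ⊢
    rw [show Finset.Icc 2 1 = ∅ from by decide, Finset.sum_empty, add_zero,
      Finset.sum_sub_distrib]
    have h1 : (n : ℝ)^2 * a 1^2 * ∑ i, (A.mulVec (x 1) i - A.mulVec x0 i)^2
        ≤ (1/2) * ∑ j, (∑ i, (A i j)^2) * (x 1 j - x0 j)^2 := by
      rw [← hfirst]
      calc _ ≤ (n : ℝ)^2 * a 1^2 * (n * ∑ j, (∑ i, (A i j)^2) * (x 1 j - x0 j)^2) := by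
            gcongr
        _ = _ := by ring
    have h2 : (1/2) * ∑ i, (A.mulVec (x 1) i)^2 - (1/2) * ∑ i, (A.mulVec xs i)^2
        - ∑ i, (A.mulVec (x 1) i - A.mulVec x0 i) * (A.mulVec (x 1) i - A.mulVec xs i)
        ≤ ∑ i, A.mulVec x0 i * (A.mulVec (x 1) i - A.mulVec xs i) := by
      simp only [Finset.mul_sum, ← Finset.sum_sub_distrib]
      refine Finset.sum_le_sum fun i _ => ?_
      nlinarith [sq_nonneg (A.mulVec (x 1) i - A.mulVec xs i)]
    nlinarith [mul_le_mul_of_nonneg_left h2 ha.le]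
  | succ k hk ih =>
    have ih := ih (by omega)
    obtain ⟨ha', hB⟩ := hpos k hk
    obtain ⟨ha, hB'⟩ := hpos (k+1) (by omega)
    have hxk := hxt k hk hkK
    rw [Finset.sum_Icc_succ_top (by omega)]
    simp only [Nat.add_sub_cancel]
    -- the matrix-vector products of the step
    have hmy : ∀ i, (Aseq k + a (k+1)) * y (k+1) i = Aseq k * y k i
        + a (k+1) * ((n : ℝ) * A.mulVec (x (k+1)) i - ((n:ℝ) - 1) * A.mulVec (x k) i) := by
      intro i
      rw [hy k hk (by omega), hy (k+1) (by omega) hkK]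
      simp only [Matrix.mulVec, dotProduct, Finset.mul_sum, ← Finset.sum_sub_distrib,
        ← Finset.sum_add_distrib]
      refine Finset.sum_congr rfl fun j _ => ?_
      have := hxk j
      rw [hArec] at this
      linear_combination (A i j) * this
    have hmyb : ∀ i, a (k+1) * yb k i = a (k+1) * y k i + a k * (y k i - y (k-1) i) := by
      intro i
      rw [hyb k hk hkK]
      simp only [Pi.add_apply, Pi.smul_apply, Pi.sub_apply, smul_eq_mul]
      field_simp
    have hG := grad_sum A (yb k)
      (fun j => ((n : ℝ) * x (k+1) j - ((n : ℝ) - 1) * x k j) - xs j)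
    have hmz : ∀ i, A.mulVec (fun j => ((n : ℝ) * x (k+1) j - ((n : ℝ) - 1) * x k j) - xs j) i
        = (n : ℝ) * A.mulVec (x (k+1)) i - ((n : ℝ) - 1) * A.mulVec (x k) i
          - A.mulVec xs i := by
      intro i
      simp only [Matrix.mulVec, dotProduct, Finset.mul_sum, ← Finset.sum_sub_distrib]
      refine Finset.sum_congr rfl fun j _ => by ring
    have hS := mulVec_sq_single A (fun j => x (k+1) j - x k j) (J (k+1))
      (fun j hj => by rw [hsingle k hk hkK j hj, sub_self])
    have hs2 : A.mulVec (fun j => x (k+1) j - x k j) = A.mulVec (x (k+1)) - A.mulVec (x k) :=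
      Matrix.mulVec_sub A (x (k+1)) (x k)
    rw [hs2] at hS
    rw [hG, ← hS]
    simp only [hmz, Pi.sub_apply]
    have hsc : ∀ i, _ := fun i => scalar_step n (a (k+1)) (a k) (Aseq k) (y (k+1) i) (y k i)
      (A.mulVec xs i) (A.mulVec (x (k+1)) i) (A.mulVec (x k) i) (y k i - y (k-1) i) (yb k i)
      hn' ha ha' (hgrow k hk) (hmyb i) (hmy i)
    have hsum := Finset.sum_le_sum (s := Finset.univ) fun i _ => hsc i
    -- the linear part
    have hlin : (Aseq k + a (k+1)) * ∑ j, xt (k+1) j = Aseq k * ∑ j, xt k j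
        + a (k+1) * ∑ j, ((n : ℝ) * x (k+1) j - ((n : ℝ) - 1) * x k j) := by
      simp only [Finset.mul_sum, ← Finset.sum_add_distrib]
      refine Finset.sum_congr rfl fun j _ => ?_
      rw [← hArec, hxk]
    have hlin2 : ∑ j, ((n : ℝ) * x (k+1) j - ((n : ℝ) - 1) * x k j - xs j)
        = ∑ j, ((n : ℝ) * x (k+1) j - ((n : ℝ) - 1) * x k j) - ∑ j, xs j :=
      Finset.sum_sub_distrib ..
    have eL : ∑ i, ((1/2) * (Aseq k + a (k+1)) * (y (k+1) i^2 - A.mulVec xs i^2)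
        - (1/2) * Aseq k * (y k i^2 - A.mulVec xs i^2)
        - a (k+1) * (y (k+1) i - y k i) * (A.mulVec (x (k+1)) i - A.mulVec xs i)
        + a k * (y k i - y (k-1) i) * (A.mulVec (x k) i - A.mulVec xs i)
        + (n:ℝ)^2 * a (k+1)^2 * (y (k+1) i - y k i)^2
        - (n:ℝ)^2 * a k^2 * (y k i - y (k-1) i)^2)
      = (1/2) * (Aseq k + a (k+1)) * (∑ i, y (k+1) i^2 - ∑ i, A.mulVec xs i^2)
        - (1/2) * Aseq k * (∑ i, y k i^2 - ∑ i, A.mulVec xs i^2)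
        - a (k+1) * ∑ i, (y (k+1) i - y k i) * (A.mulVec (x (k+1)) i - A.mulVec xs i)
        + a k * ∑ i, (y k i - y (k-1) i) * (A.mulVec (x k) i - A.mulVec xs i)
        + (n:ℝ)^2 * a (k+1)^2 * ∑ i, (y (k+1) i - y k i)^2
        - (n:ℝ)^2 * a k^2 * ∑ i, (y k i - y (k-1) i)^2 := by
      simp only [Finset.mul_sum, ← Finset.sum_sub_distrib, ← Finset.sum_add_distrib]
      refine Finset.sum_congr rfl fun j _ => by ring
    have eR : ∑ i, ((1/2) * (A.mulVec (x (k+1)) i - A.mulVec (x k) i)^2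
        + a (k+1) * yb k i * ((n:ℝ) * A.mulVec (x (k+1)) i - ((n:ℝ)-1) * A.mulVec (x k) i
          - A.mulVec xs i))
      = (1/2) * ∑ i, (A.mulVec (x (k+1)) i - A.mulVec (x k) i)^2
        + a (k+1) * ∑ i, yb k i * ((n:ℝ) * A.mulVec (x (k+1)) i - ((n:ℝ)-1) * A.mulVec (x k) i
          - A.mulVec xs i) := by
      simp only [Finset.mul_sum, ← Finset.sum_add_distrib]
      refine Finset.sum_congr rfl fun j _ => by ring
    rw [eL, eR] at hsum
    rw [hlin2, hArec k]
    linarith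

/-- the deterministic inequality for one index sequence -/
theorem core {m n : ℕ} (hn : 4 ≤ n) (A : Matrix (Fin m) (Fin n) ℝ) (a Aseq : ℕ → ℝ)
    (hlam : ∀ j, 0 < ∑ i, (A i j)^2)
    (hpos : ∀ k, 1 ≤ k → 0 < a k ∧ 0 < Aseq k)
    (hgrow : ∀ k, 1 ≤ k → 4 * (n : ℝ)^2 * a (k+1)^2 ≤ Aseq k)
    (hfirst : (n : ℝ)^3 * a 1 ^2 = 1/2)
    (hA0 : Aseq 0 = 0)
    (hArec : ∀ k, Aseq (k+1) = Aseq k + a (k+1))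
    (K : ℕ) (hK : 1 ≤ K) (x0 xs u : Fin n → ℝ) (J : ℕ → Fin n)
    (x xt : ℕ → Fin n → ℝ) (y yb : ℕ → Fin m → ℝ) (g : ℕ → Fin n → ℝ)
    (hg : ∀ k j, g k j = (∑ i, A i j * yb (k-1) i) - 1)
    (hy0 : y 0 = A.mulVec x0) (hyb0 : yb 0 = A.mulVec x0)
    (hxt1 : xt 1 = x 1)
    (hxt : ∀ k, 1 ≤ k → k + 1 ≤ K → ∀ j, Aseq (k+1) * xt (k+1) j =
      Aseq k * xt k j + a (k+1) * ((n : ℝ) * x (k+1) j - ((n : ℝ) - 1) * x k j))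
    (hy : ∀ k, 1 ≤ k → k ≤ K → y k = A.mulVec (xt k))
    (hyb : ∀ k, 1 ≤ k → k + 1 ≤ K →
      yb k = y k + (a k / a (k+1)) • (y k - y (k-1)))
    (hx : ∀ k, 1 ≤ k → k ≤ K → ∀ j, 0 ≤ x k j ∧ x k j ≤ u j)
    (hmin : ∀ k, 1 ≤ k → k ≤ K → ∀ z : Fin n → ℝ, (∀ j, 0 ≤ z j ∧ z j ≤ u j) →
      est a g J (fun j => ∑ i, (A i j)^2) x0 k (x k)
        ≤ est a g J (fun j => ∑ i, (A i j)^2) x0 k z)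
    (hxs : ∀ j, 0 ≤ xs j ∧ xs j ≤ u j) :
    Aseq K * (((1/2) * ∑ i, (A.mulVec (xt K) i)^2 - ∑ j, xt K j)
        - ((1/2) * ∑ i, (A.mulVec xs i)^2 - ∑ j, xs j))
      + ∑ k ∈ Finset.Icc 2 K, a k * (∑ j, g k j * (xs j - x (k-1) j)
          - n * (g k (J k) * (xs (J k) - x (k-1) (J k))))
    ≤ (1/2) * ∑ j, (∑ i, (A i j)^2) * (x0 j - xs j)^2 := by
  have hn' : (4 : ℝ) ≤ n := by exact_mod_cast hn
  have hsingle : ∀ k, 1 ≤ k → k + 1 ≤ K → ∀ j, j ≠ J (k+1) → x (k+1) j = x k j := by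
    intro k hk hkK j hj
    have h1 := est_first_order a g J _ x0 u (x (k+1)) (k+1) (hx _ (by omega) hkK)
      (hmin _ (by omega) hkK) j (x k j) (hx k hk (by omega) j)
    have h2 := est_first_order a g J _ x0 u (x k) k (hx _ hk (by omega))
      (hmin _ hk (by omega)) j (x (k+1) j) (hx (k+1) (by omega) hkK j)
    rw [coef_succ_ne a g J k hk j hj] at h1
    exact coord_unique _ _ _ _ _ (hlam j) h1 h2
  have hP := potential a g J _ x0 u xs x K hK hx hmin hxs
  have hD := descent (by omega) A a Aseq hpos hgrow hfirst hA0 hArec K x0 xs J x xt y yb hy0 hyb0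
    hxt1 hxt hy hyb hsingle K hK le_rfl
  have hsum : ∑ i ∈ Finset.Icc 2 K, ((1/2) * ∑ j, (∑ i, (A i j)^2) * (x i j - x (i-1) j)^2
        + (n : ℝ) * a i * (g i (J i) * (x i (J i) - xs (J i))))
      = ∑ i ∈ Finset.Icc 2 K, ((1/2) * ∑ j, (∑ i, (A i j)^2) * (x i j - x (i-1) j)^2
        + a i * ∑ j, ((∑ i', A i' j * yb (i-1) i') - 1)
            * (((n : ℝ) * x i j - ((n : ℝ) - 1) * x (i-1) j) - xs j))
        + ∑ k ∈ Finset.Icc 2 K, a k * (∑ j, g k j * (xs j - x (k-1) j)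
          - n * (g k (J k) * (xs (J k) - x (k-1) (J k)))) := by
    rw [← Finset.sum_add_distrib]
    refine Finset.sum_congr rfl fun k hk => ?_
    rw [Finset.mem_Icc] at hk
    obtain ⟨l, rfl⟩ : ∃ l, k = l + 1 := ⟨k - 1, by omega⟩
    have hgl : ∀ j, (∑ i', A i' j * yb l i') - 1 = g (l+1) j := fun j => (hg (l+1) j).symm
    simp only [Nat.add_sub_cancel, hgl]
    have e : ∑ j, g (l+1) j * (((n : ℝ) * x (l+1) j - ((n : ℝ) - 1) * x l j) - xs j)
        = n * (g (l+1) (J (l+1)) * (x (l+1) (J (l+1)) - x l (J (l+1))))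
          - ∑ j, g (l+1) j * (xs j - x l j) := by
      rw [← Finset.sum_eq_single (s := Finset.univ)
        (f := fun j => g (l+1) j * (x (l+1) j - x l j)) (J (l+1))
        (fun j _ hj => by rw [hsingle l (by omega) hk.2 j hj]; ring) (by simp), Finset.mul_sum,
        ← Finset.sum_sub_distrib]
      refine Finset.sum_congr rfl fun j _ => by ring
    rw [e]; ring
  have hg1 : ∀ j, g 1 j = (∑ i, A i j * yb 0 i) - 1 := fun j => hg 1 j
  simp only [← hg1] at hD
  -- final term
  have hC := mulVec_sq_le A (fun j => x K j - xs j)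
  have hs2 : A.mulVec (fun j => x K j - xs j) = A.mulVec (x K) - A.mulVec xs :=
    Matrix.mulVec_sub A (x K) xs
  rw [hs2] at hC
  simp only [Pi.sub_apply] at hC
  have hF : a K * ∑ i, (y K i - y (K-1) i) * (A.mulVec (x K) i - A.mulVec xs i)
      ≤ (n : ℝ)^2 * a K^2 * ∑ i, (y K i - y (K-1) i)^2
        + (1/2) * ∑ j, (∑ i, (A i j)^2) * (x K j - xs j)^2 := by
    have h1 : a K * ∑ i, (y K i - y (K-1) i) * (A.mulVec (x K) i - A.mulVec xs i)
        ≤ (n : ℝ)^2 * a K^2 * ∑ i, (y K i - y (K-1) i)^2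
          + (1 / (2 * n)) * ∑ i, (A.mulVec (x K) i - A.mulVec xs i)^2 := by
      simp only [Finset.mul_sum, ← Finset.sum_add_distrib]
      refine Finset.sum_le_sum fun i _ => ?_
      generalize y K i - y (K-1) i = d
      generalize A.mulVec (x K) i - A.mulVec xs i = w
      have hh : 0 ≤ (1 / (2 * (n:ℝ))) * (n * a K * d - w)^2 := by positivity
      have h3 : (1 / (2 * (n:ℝ))) * (n * a K * d - w)^2
        = n / 2 * (a K * d)^2 - a K * (d * w) + (1 / (2 * (n:ℝ))) * w^2 := by
        field_simp
        ring
      have h4 : n / 2 * (a K * d)^2 ≤ (n:ℝ)^2 * (a K * d)^2 := by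
        apply mul_le_mul_of_nonneg_right _ (sq_nonneg _)
        nlinarith
      nlinarith
    have h2 : (1 / (2 * (n:ℝ))) * ∑ i, (A.mulVec (x K) i - A.mulVec xs i)^2
        ≤ (1/2) * ∑ j, (∑ i, (A i j)^2) * (x K j - xs j)^2 := by
      calc _ ≤ (1 / (2 * (n:ℝ))) * (n * ∑ j, (∑ i, (A i j)^2) * (x K j - xs j)^2) := by
            gcongr
        _ = _ := by field_simp
    linarith
  have sw1 : ∑ j, (∑ i, (A i j)^2) * (xs j - x K j)^2
      = ∑ j, (∑ i, (A i j)^2) * (x K j - xs j)^2 :=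
    Finset.sum_congr rfl fun j _ => by ring
  have sw2 : ∑ j, (∑ i, (A i j)^2) * (xs j - x0 j)^2
      = ∑ j, (∑ i, (A i j)^2) * (x0 j - xs j)^2 :=
    Finset.sum_congr rfl fun j _ => by ring
  rw [hsum, sw1, sw2] at hP
  rw [← hy K hK le_rfl]
  linarith

end SINNLS

namespace SINNLS

/-- optimality of the minimizer over the orthant, and the box bound -/
theorem xstar_facts {m n : ℕ} (A : Matrix (Fin m) (Fin n) ℝ)
    (hA_nonneg : ∀ i j, 0 ≤ A i j)
    (hlam : ∀ j, 0 < ∑ i, (A i j)^2)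
    (f : (Fin n → ℝ) → ℝ)
    (hf : ∀ x, f x = (1/2) * ∑ i, (A.mulVec x i)^2 - ∑ j, x j)
    (xs : Fin n → ℝ) (hxs : ∀ j, 0 ≤ xs j)
    (hmin : ∀ z : Fin n → ℝ, (∀ j, 0 ≤ z j) → f xs ≤ f z) :
    (∀ z : Fin n → ℝ, (∀ j, 0 ≤ z j) →
      ∑ j, ((∑ i, A i j * A.mulVec z i) - 1) * (z j - xs j) ≤ 2 * (f z - f xs)) ∧
    (∀ j, 0 ≤ xs j ∧ xs j ≤ 1 / ∑ i, (A i j)^2) := by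
  have hexp : ∀ z w : Fin n → ℝ, ∀ t : ℝ, f (w + t • (z - w)) = f w
      + t * ∑ j, ((∑ i, A i j * A.mulVec w i) - 1) * (z j - w j)
      + t^2 * ((1/2) * ∑ i, (A.mulVec z i - A.mulVec w i)^2) := by
    intro z w t
    rw [hf, hf, grad_sum A _ (fun j => z j - w j)]
    have h1 : A.mulVec (fun j => z j - w j) = A.mulVec z - A.mulVec w :=
      Matrix.mulVec_sub A z w
    rw [h1, Matrix.mulVec_add, Matrix.mulVec_smul, Matrix.mulVec_sub]
    simp only [Pi.add_apply, Pi.smul_apply, Pi.sub_apply, smul_eq_mul]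
    have e1 : ∑ i, (A.mulVec w i + t * (A.mulVec z i - A.mulVec w i))^2
        = ∑ i, (A.mulVec w i)^2 + 2 * t * ∑ i, A.mulVec w i * (A.mulVec z i - A.mulVec w i)
          + t^2 * ∑ i, (A.mulVec z i - A.mulVec w i)^2 := by
      simp only [Finset.mul_sum, ← Finset.sum_add_distrib]
      exact Finset.sum_congr rfl fun i _ => by ring
    have e2 : ∑ j, (w j + t * (z j - w j)) = ∑ j, w j + t * ∑ j, (z j - w j) := by
      simp only [Finset.mul_sum, ← Finset.sum_add_distrib]
    rw [e1, e2]; ring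
  have hfo : ∀ z : Fin n → ℝ, (∀ j, 0 ≤ z j) →
      0 ≤ ∑ j, ((∑ i, A i j * A.mulVec xs i) - 1) * (z j - xs j) := by
    intro z hz
    apply slope_nonneg _ ((1/2) * ∑ i, (A.mulVec z i - A.mulVec xs i)^2)
    intro t h0 h1
    have h := hmin (xs + t • (z - xs)) (by
      intro j
      simp only [Pi.add_apply, Pi.smul_apply, Pi.sub_apply, smul_eq_mul]
      nlinarith [hz j, hxs j, mul_nonneg h0.le (hz j), mul_nonneg (sub_nonneg.2 h1) (hxs j)])
    rw [hexp] at h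
    linarith
  refine ⟨fun z hz => ?_, fun j => ⟨hxs j, ?_⟩⟩
  · have h1 := hexp z xs 1
    have h2 := hexp xs z 1
    simp only [one_smul, add_sub_cancel, one_mul, one_pow] at h1 h2
    have h3 := hfo z hz
    have e1 : ∑ j, ((∑ i, A i j * A.mulVec z i) - 1) * (xs j - z j)
        = - ∑ j, ((∑ i, A i j * A.mulVec z i) - 1) * (z j - xs j) := by
      rw [← Finset.sum_neg_distrib]
      exact Finset.sum_congr rfl fun j _ => by ring
    have e2 : ∑ i, (A.mulVec xs i - A.mulVec z i)^2
        = ∑ i, (A.mulVec z i - A.mulVec xs i)^2 :=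
      Finset.sum_congr rfl fun j _ => by ring
    rw [e1, e2] at h2
    linarith
  · rcases (hxs j).eq_or_lt with h0 | h0
    · rw [← h0]; have := hlam j; positivity
    have h := hfo (Function.update xs j 0) (by
      intro i
      rcases eq_or_ne i j with rfl | hij
      · simp
      · simpa [Function.update_of_ne hij] using hxs i)
    rw [Finset.sum_eq_single j (fun i _ hij => by rw [Function.update_of_ne hij]; ring)
      (by simp), Function.update_self] at h
    have h1 : (∑ i, A i j * A.mulVec xs i) - 1 ≤ 0 := by
      by_contra hc
      push Not at hc
      nlinarith [mul_pos hc h0]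
    have h2 : (∑ i, (A i j)^2) * xs j ≤ ∑ i, A i j * A.mulVec xs i := by
      rw [Finset.sum_mul]
      refine Finset.sum_le_sum fun i _ => ?_
      have h3 : A i j * xs j ≤ A.mulVec xs i := by
        simp only [Matrix.mulVec, dotProduct]
        exact Finset.single_le_sum (f := fun j => A i j * xs j)
          (fun k _ => mul_nonneg (hA_nonneg i k) (hxs k)) (Finset.mem_univ j)
      nlinarith [mul_le_mul_of_nonneg_left h3 (hA_nonneg i j)]
    rw [le_div_iff₀ (hlam j)]
    linarith

end SINNLS

/-- Main convergence theorem for SI-NNLS+ (Theorem 3.5), phrased with the expectation over the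
uniformly random coordinate sequence written as a uniform average over all `n^(K−1)` index
sequences `j = (j₂, …, j_K)`: the averaged primal error of `x̃_K` is at most
`‖x₀ − x⋆‖_Λ²/(2A_K)` and the averaged quantity `⟨∇f(x̃_K), x̃_K − x⋆⟩` is at most
`‖x₀ − x⋆‖_Λ²/A_K`. -/
theorem SI_NNLS_plus_convergence {m n : ℕ} (hm : 0 < m) (hn : 4 ≤ n)
    (A : Matrix (Fin m) (Fin n) ℝ)
    (hA_nonneg : ∀ i j, 0 ≤ A i j)
    (hA_cols : ∀ j, ∃ i, A i j ≠ 0)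
    (f : (Fin n → ℝ) → ℝ)
    (hf : ∀ x, f x = (1/2) * ∑ i, (A.mulVec x i)^2 - ∑ j, x j)
    (xstar : Fin n → ℝ)
    (hxs_nonneg : ∀ j, 0 ≤ xstar j)
    (hxs_min : ∀ z : Fin n → ℝ, (∀ j, 0 ≤ z j) → f xstar ≤ f z)
    (X : Set (Fin n → ℝ))
    (hX : X = {z | ∀ j, 0 ≤ z j ∧ z j ≤ 1 / ∑ i, (A i j)^2})
    -- the scalar step-size sequences
    (a Aseq : ℕ → ℝ)
    (ha1 : a 1 = 1 / (Real.sqrt 2 * (n : ℝ) ^ ((3:ℝ)/2)))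
    (ha2 : a 2 = a 1 / ((n : ℝ) - 1))
    (hA0 : Aseq 0 = 0)
    (hArec : ∀ k, Aseq (k+1) = Aseq k + a (k+1))
    (harec : ∀ k, 1 ≤ k →
      a (k+2) = min ((n : ℝ) * a (k+1) / ((n : ℝ) - 1)) (Real.sqrt (Aseq (k+1)) / (2 * n)))
    -- horizon and initialization
    (K : ℕ) (hK : 2 ≤ K)
    (x0 : Fin n → ℝ) (hx0 : x0 ∈ X)
    -- for an index sequence `js = (j₂,…,j_K)`, `J js i` is the coordinate `j_i` (for `2 ≤ i ≤ K`)
    (J : (Fin (K-1) → Fin n) → ℕ → Fin n)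
    (hJ : ∀ (js : Fin (K-1) → Fin n) (i : ℕ),
      J js i = js ⟨(i - 2) % (K - 1), Nat.mod_lt _ (by omega)⟩)
    -- iterates, one family per index sequence
    (x xt : (Fin (K-1) → Fin n) → ℕ → (Fin n → ℝ))
    (y yb : (Fin (K-1) → Fin n) → ℕ → (Fin m → ℝ))
    -- the dual estimate sequence
    (φ : (Fin (K-1) → Fin n) → ℕ → (Fin n → ℝ) → ℝ)
    (hφ : ∀ js k z, φ js k z =
      a 1 * (∑ j, ((∑ i, A i j * yb js 0 i) - 1) * z j)
      + (∑ i ∈ Finset.Icc 2 k, (n : ℝ) * a i *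
          (((∑ i', A i' (J js i) * yb js (i-1) i') - 1) * z (J js i)))
      + (1/2) * ∑ j, (∑ i, (A i j)^2) * (z j - x0 j)^2)
    -- initialization of the iterates
    (hy0 : ∀ js, y js 0 = A.mulVec x0)
    (hyb0 : ∀ js, yb js 0 = A.mulVec x0)
    -- x₁ minimizes φ₁ (whose coordinate sum is empty) over X; x_k minimizes φ_k over X
    (hx_min : ∀ js k, 1 ≤ k → k ≤ K →
      x js k ∈ X ∧ ∀ z ∈ X, φ js k (x js k) ≤ φ js k z)
    -- averaged iterates
    (hxt1 : ∀ js, xt js 1 = x js 1)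
    (hxt : ∀ js k, 2 ≤ k → k ≤ K → xt js k = (1 / Aseq k) •
      (Aseq (k-1) • xt js (k-1) + a k • ((n : ℝ) • x js k - ((n : ℝ) - 1) • x js (k-1))))
    -- dual iterates and extrapolation
    (hy : ∀ js k, 1 ≤ k → k ≤ K → y js k = A.mulVec (xt js k))
    (hyb : ∀ js k, 1 ≤ k → k + 1 ≤ K →
      yb js k = y js k + (a k / a (k+1)) • (y js k - y js (k-1))) :
    (1 / (n : ℝ) ^ (K - 1)) *
        (∑ js : Fin (K-1) → Fin n, (f (xt js K) - f xstar)) ≤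
      (∑ j, (∑ i, (A i j)^2) * (x0 j - xstar j)^2) / (2 * Aseq K) ∧
    (1 / (n : ℝ) ^ (K - 1)) *
        (∑ js : Fin (K-1) → Fin n,
          ∑ j, ((∑ i, A i j * A.mulVec (xt js K) i) - 1) * (xt js K j - xstar j)) ≤
      (∑ j, (∑ i, (A i j)^2) * (x0 j - xstar j)^2) / Aseq K := by
  have hn' : (4 : ℝ) ≤ n := by exact_mod_cast hn
  obtain ⟨hpos, hgrow, hratio, hfirst⟩ := SINNLS.seq_facts hn a Aseq ha1 ha2 hA0 hArec harec
  have hlam : ∀ j, 0 < ∑ i, (A i j)^2 := by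
    intro j
    obtain ⟨i, hi⟩ := hA_cols j
    exact Finset.sum_pos' (fun i _ => sq_nonneg _) ⟨i, Finset.mem_univ _, by positivity⟩
  obtain ⟨hfo, hxs⟩ := SINNLS.xstar_facts A hA_nonneg hlam f hf xstar hxs_nonneg hxs_min
  subst hX
  -- rewrite in terms of the abstract estimate function
  let g : (Fin (K-1) → Fin n) → ℕ → Fin n → ℝ :=
    fun js k j => (∑ i, A i j * yb js (k-1) i) - 1
  have hest : ∀ js k z, φ js k z
      = SINNLS.est a (g js) (J js) (fun j => ∑ i, (A i j)^2) x0 k z := by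
    intro js k z; rw [hφ]; rfl
  have hxX : ∀ js k, 1 ≤ k → k ≤ K → ∀ j, 0 ≤ x js k j ∧ x js k j ≤ 1 / ∑ i, (A i j)^2 :=
    fun js k h1 h2 => (hx_min js k h1 h2).1
  have hmin : ∀ js k, 1 ≤ k → k ≤ K → ∀ z : Fin n → ℝ,
      (∀ j, 0 ≤ z j ∧ z j ≤ 1 / ∑ i, (A i j)^2) →
      SINNLS.est a (g js) (J js) (fun j => ∑ i, (A i j)^2) x0 k (x js k)
        ≤ SINNLS.est a (g js) (J js) (fun j => ∑ i, (A i j)^2) x0 k z := by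
    intro js k h1 h2 z hz
    have := (hx_min js k h1 h2).2 z hz
    rwa [hest, hest] at this
  have hxt' : ∀ js k, 1 ≤ k → k + 1 ≤ K → ∀ j, Aseq (k+1) * xt js (k+1) j =
      Aseq k * xt js k j + a (k+1) * ((n : ℝ) * x js (k+1) j - ((n : ℝ) - 1) * x js k j) := by
    intro js k h1 h2 j
    have hA := (hpos (k+1) (by omega)).2
    rw [hxt js (k+1) (by omega) h2]
    simp only [Nat.add_sub_cancel, Pi.smul_apply, Pi.add_apply, Pi.sub_apply, smul_eq_mul]
    field_simp
  -- the iterates are predictable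
  have hpred : ∀ k, 1 ≤ k → k ≤ K → ∀ js js', (∀ i, 2 ≤ i → i ≤ k → J js i = J js' i) →
      x js k = x js' k ∧ xt js k = xt js' k ∧ y js k = y js' k := by
    intro k
    induction k using Nat.strong_induction_on with
    | _ k ih =>
    intro h1 h2 js js' hJJ
    have hyy : ∀ l, l < k → y js l = y js' l := by
      intro l hl
      rcases Nat.eq_zero_or_pos l with rfl | hl0
      · rw [hy0, hy0]
      · exact (ih l hl hl0 (by omega) js js' fun i hi hil => hJJ i hi (by omega)).2.2
    have hyyb : ∀ l, l < k → yb js l = yb js' l := by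
      intro l hl
      rcases Nat.eq_zero_or_pos l with rfl | hl0
      · rw [hyb0, hyb0]
      · rw [hyb js l hl0 (by omega), hyb js' l hl0 (by omega), hyy l hl, hyy (l-1) (by omega)]
    have hgg : ∀ l, 1 ≤ l → l ≤ k → g js l = g js' l := by
      intro l hl hlk
      funext j
      simp only [g]
      rw [hyyb (l-1) (by omega)]
    have hcoef : ∀ j, SINNLS.coef a (g js) (J js) k j = SINNLS.coef a (g js') (J js') k j := by
      intro j
      unfold SINNLS.coef
      rw [hgg 1 le_rfl h1]
      congr 1
      refine Finset.sum_congr rfl fun i hi => ?_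
      rw [Finset.mem_Icc] at hi
      rw [hgg i (by omega) hi.2, hJJ i hi.1 hi.2]
    have hxx : x js k = x js' k := by
      funext j
      have e1 := SINNLS.est_first_order a (g js) (J js) _ x0 _ (x js k) k (hxX js k h1 h2)
        (hmin js k h1 h2) j (x js' k j) (hxX js' k h1 h2 j)
      have e2 := SINNLS.est_first_order a (g js') (J js') _ x0 _ (x js' k) k (hxX js' k h1 h2)
        (hmin js' k h1 h2) j (x js k j) (hxX js k h1 h2 j)
      rw [hcoef] at e1
      exact SINNLS.coord_unique _ _ _ _ _ (hlam j) e1 e2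
    have hxxt : xt js k = xt js' k := by
      rcases Nat.lt_or_ge 1 k with hk | hk
      · have hprev := ih (k-1) (by omega) (by omega) (by omega) js js'
          fun i hi hil => hJJ i hi (by omega)
        rw [hxt js k hk h2, hxt js' k hk h2, hprev.1, hprev.2.1, hxx]
      · obtain rfl : k = 1 := by omega
        rw [hxt1, hxt1, hxx]
    exact ⟨hxx, hxxt, by rw [hy js k h1 h2, hy js' k h1 h2, hxxt]⟩
  -- nonnegativity of the averaged iterate
  have hxtnn : ∀ js k, 1 ≤ k → k ≤ K → ∀ j,
      ((n : ℝ) - 1) * a (k+1) * x js k j ≤ Aseq k * xt js k j := by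
    intro js k hk
    induction k, hk using Nat.le_induction with
    | base =>
      intro _ j
      have hA1 : Aseq 1 = a 1 := by have := hArec 0; simpa [hA0] using this
      have hne : (n : ℝ) - 1 ≠ 0 := by linarith
      rw [hA1, hxt1, show 1 + 1 = 2 from rfl, ha2, mul_div_cancel₀ _ hne]
    | succ k hk ih =>
      intro h2 j
      have h3 := ih (by omega) j
      rw [hxt' js k hk h2 j]
      have h4 := mul_le_mul_of_nonneg_right (hratio (k+1) (by omega))
        (hxX js (k+1) (by omega) h2 j).1
      linarith
  have hAK : 0 < Aseq K := (hpos K (by omega)).2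
  have hxtK : ∀ js j, 0 ≤ xt js K j := by
    intro js j
    have h1 := hxtnn js K (by omega) le_rfl j
    have h2 : 0 ≤ ((n : ℝ) - 1) * a (K+1) * x js K j :=
      mul_nonneg (mul_nonneg (by linarith) (hpos (K+1) (by omega)).1.le)
        (hxX js K (by omega) le_rfl j).1
    exact nonneg_of_mul_nonneg_right (h2.trans h1) hAK
  -- the deterministic bound
  have hcore := fun js => SINNLS.core hn A a Aseq hlam hpos hgrow hfirst hA0 hArec K (by omega)
    x0 xstar (fun j => 1 / ∑ i, (A i j)^2) (J js) (x js) (xt js) (y js) (yb js) (g js)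
    (fun k j => rfl) (hy0 js) (hyb0 js) (hxt1 js) (hxt' js) (hy js) (hyb js) (hxX js) (hmin js) hxs
  simp only [← hf] at hcore
  -- the residuals average out
  have hmart : ∀ k ∈ Finset.Icc 2 K, ∑ js : Fin (K-1) → Fin n,
      a k * (∑ j, g js k j * (xstar j - x js (k-1) j)
          - n * (g js k (J js k) * (xstar (J js k) - x js (k-1) (J js k)))) = 0 := by
    intro k hk
    rw [Finset.mem_Icc] at hk
    let p : Fin (K-1) := ⟨k - 2, by omega⟩
    have hJp : ∀ js, J js k = js p := by
      intro js
      rw [hJ]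
      congr 1
      apply Fin.ext
      exact Nat.mod_eq_of_lt (by omega)
    have hJne : ∀ js d i, 2 ≤ i → i < k → J (Function.update js p d) i = J js i := by
      intro js d i h1 h2
      rw [hJ, hJ]
      apply Function.update_of_ne
      intro h
      have := congrArg Fin.val h
      simp only [p] at this
      rw [Nat.mod_eq_of_lt (by omega)] at this
      omega
    have hupd : ∀ js d, x (Function.update js p d) (k-1) = x js (k-1) := fun js d =>
      (hpred (k-1) (by omega) (by omega) _ _ fun i h1 h2 => hJne js d i h1 (by omega)).1
    have hupdy : ∀ js d l, l < k → y (Function.update js p d) l = y js l := by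
      intro js d l hl
      rcases Nat.eq_zero_or_pos l with rfl | hl0
      · rw [hy0, hy0]
      · exact (hpred l hl0 (by omega) _ _ fun i h1 h2 => hJne js d i h1 (by omega)).2.2
    have hupdyb : ∀ js d, yb (Function.update js p d) (k-1) = yb js (k-1) := by
      intro js d
      rw [hyb _ (k-1) (by omega) (by omega), hyb _ (k-1) (by omega) (by omega),
        hupdy js d (k-1) (by omega), hupdy js d (k-1-1) (by omega)]
    have havg := SINNLS.avg_coord p (fun js c => g js k c * (xstar c - x js (k-1) c)) (by
      intro js c d
      simp only [g, hupd, hupdyb])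
    simp only [hJp]
    rw [← Finset.mul_sum, Finset.sum_sub_distrib, ← havg, ← Finset.mul_sum, sub_self, mul_zero]
  have hsum := Finset.sum_le_sum (s := Finset.univ) fun js _ => hcore js
  rw [Finset.sum_add_distrib, Finset.sum_comm (s := Finset.univ) (t := Finset.Icc 2 K),
    Finset.sum_eq_zero hmart, add_zero, ← Finset.mul_sum, Finset.sum_const, nsmul_eq_mul] at hsum
  have hcard : ((Finset.univ : Finset (Fin (K-1) → Fin n)).card : ℝ) = (n : ℝ)^(K-1) := by
    simp
  rw [hcard] at hsum
  have hN : (0 : ℝ) < (n : ℝ)^(K-1) := by positivity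
  set R := ∑ j, (∑ i, (A i j)^2) * (x0 j - xstar j)^2 with hR
  set S := ∑ js : Fin (K-1) → Fin n, (f (xt js K) - f xstar) with hS
  have hmain : (1 / (n : ℝ) ^ (K - 1)) * S ≤ R / (2 * Aseq K) := by
    rw [le_div_iff₀ (by positivity), one_div, mul_assoc, inv_mul_le_iff₀ hN]
    linarith
  refine ⟨hmain, ?_⟩
  have hgrad : ∀ js, ∑ j, ((∑ i, A i j * A.mulVec (xt js K) i) - 1) * (xt js K j - xstar j)
      ≤ 2 * (f (xt js K) - f xstar) := fun js => hfo (xt js K) (hxtK js)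
  calc _ ≤ (1 / (n : ℝ) ^ (K - 1)) *
        ∑ js : Fin (K-1) → Fin n, 2 * (f (xt js K) - f xstar) := by
        apply mul_le_mul_of_nonneg_left _ (by positivity)
        exact Finset.sum_le_sum fun js _ => hgrad js
    _ = 2 * ((1 / (n : ℝ) ^ (K - 1)) * S) := by rw [← Finset.mul_sum]; ring
    _ ≤ 2 * (R / (2 * Aseq K)) := by linarith
    _ = R / Aseq K := by field_simp
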